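/- Let R be a relation on a set Q, let W = W₁ ∪ … ∪ Wₙ be a disjunctively well-founded relation on Q, let G' be any relation with G' ⊆ gfp(λY. W ∩ g̃(Y)) where g̃(Y) = ¬(¬Y ∘ R⁻¹), and let R_bad = R \ G'. If R_bad is well-founded (there is no infinite R_bad-trace), then R is well-founded (there is no infinite R-trace). -/

import Mathlib

/-- Composition of relations viewed as subsets of `Q × Q`:
`relComp X R = {(s,s') | ∃ s₁, (s,s₁) ∈ X ∧ (s₁,s') ∈ R}`. -/
def relComp {Q : Type*} (X R : Set (Q × Q)) : Set (Q × Q) :=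
  {p | ∃ s₁, (p.1, s₁) ∈ X ∧ (s₁, p.2) ∈ R}

/-- Inverse of a relation: `relInv R = {(s',s) | (s,s') ∈ R}`. -/
def relInv {Q : Type*} (R : Set (Q × Q)) : Set (Q × Q) :=
  {p | (p.2, p.1) ∈ R}

/-- `gtilde R Y = ¬(¬Y ∘ R⁻¹)`. -/
def gtilde {Q : Type*} (R Y : Set (Q × Q)) : Set (Q × Q) :=
  (relComp Yᶜ (relInv R))ᶜ

theorem relComp_mono {Q : Type*} {X X' : Set (Q × Q)} (R : Set (Q × Q)) (h : X ⊆ X') :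
    relComp X R ⊆ relComp X' R := fun _ ⟨s₁, h1, h2⟩ => ⟨s₁, h h1, h2⟩

/-- The monotone map `Y ↦ S ∪ (Y ∘ R)`. -/
def fwd {Q : Type*} (R S : Set (Q × Q)) : Set (Q × Q) →o Set (Q × Q) :=
  ⟨fun Y => S ∪ relComp Y R,
   fun _ _ h => Set.union_subset_union subset_rfl (relComp_mono R h)⟩

/-- The monotone map `Y ↦ W ∩ ¬(¬Y ∘ R⁻¹)`. -/
def bwd {Q : Type*} (R W : Set (Q × Q)) : Set (Q × Q) →o Set (Q × Q) :=
  ⟨fun Y => W ∩ gtilde R Y,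
   fun _ _ h => Set.inter_subset_inter subset_rfl
     (Set.compl_subset_compl.2 (relComp_mono (relInv R) (Set.compl_subset_compl.2 h)))⟩

/-- Transitive closure of a relation viewed as a subset of `Q × Q`. -/
def transClos {Q : Type*} (R : Set (Q × Q)) : Set (Q × Q) :=
  {p | Relation.TransGen (fun a b => (a, b) ∈ R) p.1 p.2}

/-- Reflexive-transitive closure of a relation viewed as a subset of `Q × Q`. -/
def reflTransClos {Q : Type*} (R : Set (Q × Q)) : Set (Q × Q) :=
  {p | Relation.ReflTransGen (fun a b => (a, b) ∈ R) p.1 p.2}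


/-- A sequence whose forward pairs all lie in a finite union of relations has a trace of
one of these relations. -/
theorem exists_trace_of_forall_lt_mem_biUnion {Q ι : Type*} (Ws : ι → Set (Q × Q))
    (S : Finset ι) (f : ℕ → Q) (hf : ∀ i j, i < j → ∃ a ∈ S, (f i, f j) ∈ Ws a) :
    ∃ a ∈ S, ∃ s : ℕ → Q, ∀ k, (s k, s (k + 1)) ∈ Ws a := by
  classical
  induction S using Finset.induction_on generalizing f with
  | empty => simpa using hf 0 1 one_pos
  | insert a S _ ih =>
    obtain ⟨g, hg | hg⟩ :=
      exists_increasing_or_nonincreasing_subseq' (fun x y => (x, y) ∈ Ws a) f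
    · exact ⟨a, Finset.mem_insert_self a S, fun k => f (g k), hg⟩
    · obtain ⟨b, hb, s, hs⟩ := ih (fun k => f (g k)) fun i j hij => by
        obtain ⟨b, hb, hmem⟩ := hf (g i) (g j) (g.strictMono hij)
        rcases Finset.mem_insert.1 hb with rfl | hb
        · exact (hg i j hij hmem).elim
        · exact ⟨b, hb, hmem⟩
      exact ⟨b, Finset.mem_insert_of_mem hb, s, hs⟩

theorem gfp_bwd_subset {Q : Type*} (R W : Set (Q × Q)) : OrderHom.gfp (bwd R W) ⊆ W :=
  fun _ hp => ((bwd R W).map_gfp.ge hp).1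

theorem mem_gfp_bwd_of_step {Q : Type*} {R W : Set (Q × Q)} {a b c : Q}
    (hab : (a, b) ∈ OrderHom.gfp (bwd R W)) (hbc : (b, c) ∈ R) :
    (a, c) ∈ OrderHom.gfp (bwd R W) := by
  by_contra hac
  exact ((bwd R W).map_gfp.ge hab).2 ⟨c, hac, hbc⟩

/-- if W = W₁ ∪ ... ∪ Wₙ is disjunctively well-founded,
G' ⊆ gfp (λ Y. W ∩ g̃ Y), R_bad = R \ G' and R_bad is well-founded,
then R is well-founded. -/
theorem stmt14 {Q : Type*} (R W : Set (Q × Q)) (n : ℕ) (Ws : Fin n → Set (Q × Q))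
    (hW : W = ⋃ i, Ws i)
    (hwf : ∀ i, ¬∃ s : ℕ → Q, ∀ k, (s k, s (k + 1)) ∈ Ws i)
    (G' : Set (Q × Q)) (hG : G' ⊆ OrderHom.gfp (bwd R W))
    (hbad : ¬∃ s : ℕ → Q, ∀ k, (s k, s (k + 1)) ∈ R \ G') :
    ¬∃ s : ℕ → Q, ∀ k, (s k, s (k + 1)) ∈ R := by
  rintro ⟨s, hs⟩
  have hfreq : ∀ N, ∃ m > N, (s m, s (m + 1)) ∈ G' := by
    intro N
    by_contra! hN
    exact hbad ⟨fun k => s (N + 1 + k), fun k => ⟨hs _, hN _ (by omega)⟩⟩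
  obtain ⟨φ, hφ, hφG⟩ := Nat.exists_strictMono_subsequence hfreq
  have hgfp : ∀ k j, k + 1 ≤ j → (s k, s (k + 1)) ∈ G' →
      (s k, s j) ∈ OrderHom.gfp (bwd R W) := by
    intro k j hkj hk
    induction j, hkj using Nat.le_induction with
    | base => exact hG hk
    | succ j _ ih => exact mem_gfp_bwd_of_step ih (hs j)
  obtain ⟨i, -, htrace⟩ := exists_trace_of_forall_lt_mem_biUnion Ws Finset.univ
    (fun k => s (φ k)) fun i j hij => by
      have hmem := gfp_bwd_subset R W (hgfp _ _ (hφ hij) (hφG i))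
      rw [hW] at hmem
      simpa using hmem
  exact hwf i htrace
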